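/- arXiv:2305.01106 — 10 statements merged into one kernel-verified Lean document; each statement's English description precedes it below -/
import Mathlib

section
/- Fix an integer m ≥ 1, channel gains g_1,…,g_m > 0, a partition of {1,…,m} into disjoint nonempty groups I(1),…,I(s), a total power P_T > 0 and per-group powers P_1,…,P_s > 0. Let μ ≥ 0 and λ_1,…,λ_s ≥ 0 satisfy μ + λ_j > 0 for every j, and for each i ∈ I(j) define p*_i = ((μ+λ_j)^{-1} − g_i^{-1})_+. Assume that p* lies in the feasible set S_P, that μ·(∑_{i=1}^m p*_i − P_T) = 0, and that λ_j·(∑_{i∈I(j)} p*_i − P_j) = 0 for every j. Then for every p ∈ S_P, ∑_{i=1}^m ln(1 + g_i p_i) ≤ ∑_{i=1}^m ln(1 + g_i p*_i); that is, p* is an optimal power allocation. -/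
open Finset

/-- The water-filling level `(ν⁻¹ - a⁻¹)_+` maximizes `x ↦ log (1 + a * x) - ν * x` over
the nonnegative reals. -/
theorem log_one_add_mul_le_waterfilling {a ν x : ℝ} (ha : 0 < a) (hν : 0 < ν) (hx : 0 ≤ x) :
    Real.log (1 + a * x) ≤
      Real.log (1 + a * max (ν⁻¹ - a⁻¹) 0) + ν * (x - max (ν⁻¹ - a⁻¹) 0) := by
  rcases le_total a ν with h | h
  · have hq : ν⁻¹ - a⁻¹ ≤ 0 := sub_nonpos.2 (inv_anti₀ ha h)
    rw [max_eq_right hq]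
    have hlog := Real.log_le_sub_one_of_pos (show 0 < 1 + a * x by positivity)
    have hmul := mul_le_mul_of_nonneg_right h hx
    simp only [mul_zero, add_zero, Real.log_one, zero_add, sub_zero]
    linarith
  · have hq : 0 ≤ ν⁻¹ - a⁻¹ := sub_nonneg.2 (inv_anti₀ hν h)
    rw [max_eq_left hq]
    have hlevel : 1 + a * (ν⁻¹ - a⁻¹) = a / ν := by field_simp; ring
    have hpos : 0 < 1 + a * x := by positivity
    have hlog := Real.log_le_sub_one_of_pos (div_pos hpos (div_pos ha hν))
    rw [Real.log_div hpos.ne' (div_pos ha hν).ne'] at hlog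
    have hslope : (1 + a * x) / (a / ν) - 1 = ν * (x - (ν⁻¹ - a⁻¹)) := by
      field_simp
      ring
    rw [hlevel]
    linarith

/-- A sum weighted by a function of the fiber is the weighted sum of the fiber sums. -/
theorem sum_comp_mul_eq_sum_fiberwise {ι κ R : Type*} [Fintype ι] [Fintype κ] [DecidableEq κ]
    [NonUnitalNonAssocSemiring R] (f : ι → κ) (c : κ → R) (q : ι → R) :
    ∑ i, c (f i) * q i = ∑ j, c j * ∑ i ∈ univ.filter (fun i => f i = j), q i := by
  rw [← Finset.sum_fiberwise univ f]
  refine Finset.sum_congr rfl fun j _ => ?_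
  rw [Finset.mul_sum]
  refine Finset.sum_congr rfl fun i hi => ?_
  rw [(Finset.mem_filter.1 hi).2]

/-- KKT sufficiency for the fixed orthogonal MIMO channel under joint total
and per-group power constraints.  The antennas `{0, …, m-1}` are partitioned into `s` disjoint
nonempty groups via the surjective assignment map `grp : Fin m → Fin s` (the group `I(j)` is
the fiber `grp ⁻¹ {j}`).  If `μ ≥ 0` and `λ j ≥ 0` satisfy `μ + λ j > 0`, the water-filling
style allocation `p*_i = ((μ + λ_{grp i})⁻¹ - g_i⁻¹)_+` is feasible, and the complementary
slackness conditions hold, then `p*` maximizes `∑ i, ln (1 + g i * p i)` over the feasible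
set. -/
theorem stmt_0
    (m s : ℕ) (hm : 1 ≤ m)
    (g : Fin m → ℝ) (hg : ∀ i, 0 < g i)
    (grp : Fin m → Fin s) (hgrp : Function.Surjective grp)
    (PT : ℝ) (hPT : 0 < PT)
    (P : Fin s → ℝ) (hP : ∀ j, 0 < P j)
    (μ : ℝ) (hμ : 0 ≤ μ)
    (lam : Fin s → ℝ) (hlam : ∀ j, 0 ≤ lam j)
    (hμlam : ∀ j, 0 < μ + lam j)
    (pstar : Fin m → ℝ)
    (hpstar : ∀ i, pstar i = max ((μ + lam (grp i))⁻¹ - (g i)⁻¹) 0)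
    -- feasibility of `p*`
    (hfeas₁ : ∀ i, 0 ≤ pstar i)
    (hfeas₂ : ∑ i, pstar i ≤ PT)
    (hfeas₃ : ∀ j, ∑ i ∈ univ.filter (fun i => grp i = j), pstar i ≤ P j)
    -- complementary slackness
    (hslackT : μ * (∑ i, pstar i - PT) = 0)
    (hslackG : ∀ j, lam j * ((∑ i ∈ univ.filter (fun i => grp i = j), pstar i) - P j) = 0) :
    ∀ p : Fin m → ℝ,
      (∀ i, 0 ≤ p i) →
      (∑ i, p i ≤ PT) →
      (∀ j, ∑ i ∈ univ.filter (fun i => grp i = j), p i ≤ P j) →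
      ∑ i, Real.log (1 + g i * p i) ≤ ∑ i, Real.log (1 + g i * pstar i) := by
  intro p hp hpT hpG
  have hlog : ∑ i, Real.log (1 + g i * p i) ≤
      ∑ i, (Real.log (1 + g i * pstar i) + (μ + lam (grp i)) * (p i - pstar i)) := by
    refine Finset.sum_le_sum fun i _ => ?_
    rw [hpstar i]
    exact log_one_add_mul_le_waterfilling (hg i) (hμlam _) (hp i)
  have htotal : μ * (∑ i, p i) ≤ μ * ∑ i, pstar i := by
    linarith [mul_le_mul_of_nonneg_left hpT hμ]
  have hgroup : ∑ i, lam (grp i) * p i ≤ ∑ i, lam (grp i) * pstar i := by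
    rw [sum_comp_mul_eq_sum_fiberwise grp lam, sum_comp_mul_eq_sum_fiberwise grp lam]
    refine Finset.sum_le_sum fun j _ => ?_
    linarith [mul_le_mul_of_nonneg_left (hpG j) (hlam j), hslackG j]
  simp only [add_mul, mul_sub, Finset.sum_add_distrib, Finset.sum_sub_distrib,
    ← Finset.mul_sum] at hlog
  linarith
end

section
/- Let W = diag(g_1,…,g_m) be a diagonal m×m complex matrix with g_i ≥ 0, and let R be an m×m complex Hermitian positive semidefinite matrix with diagonal entries p_i = R_{ii} (which are real and nonnegative). Then the determinant det(I + W·R) is a real number and satisfies det(I + W·R) ≤ ∏_{i=1}^m (1 + g_i p_i) = det(I + W·diag(p_1,…,p_m)). -/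
open Matrix ComplexOrder

/-- A positive definite matrix with unit diagonal has determinant at most `1`. -/
theorem Matrix.PosDef.det_le_one_of_diag_eq_one {n 𝕜 : Type*} [Fintype n] [DecidableEq n]
    [RCLike 𝕜] {A : Matrix n n 𝕜} (hA : A.PosDef) (h : ∀ i, A i i = 1) : A.det ≤ 1 := by
  have htr : ∑ i, hA.isHermitian.eigenvalues i = ∑ _i : n, (1 : ℝ) := by
    have := hA.isHermitian.trace_eq_sum_eigenvalues
    simp only [Matrix.trace, Matrix.diag, h] at this
    exact_mod_cast this.symm
  have hprod : ∏ i, hA.isHermitian.eigenvalues i ≤ 1 := calc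
    _ ≤ ∏ i, Real.exp (hA.isHermitian.eigenvalues i - 1) :=
      Finset.prod_le_prod (fun i _ => (hA.eigenvalues_pos i).le)
        fun i _ => by simpa using Real.add_one_le_exp (hA.isHermitian.eigenvalues i - 1)
    _ = 1 := by rw [← Real.exp_sum, Finset.sum_sub_distrib, htr, sub_self, Real.exp_zero]
  rw [hA.isHermitian.det_eq_prod_eigenvalues]
  exact_mod_cast hprod

/-- **Hadamard's inequality**: the determinant of a positive definite matrix is at most the
product of its diagonal entries. -/
theorem Matrix.PosDef.det_le_prod_diag {n 𝕜 : Type*} [Fintype n] [DecidableEq n]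
    [RCLike 𝕜] {A : Matrix n n 𝕜} (hA : A.PosDef) : A.det ≤ ∏ i, A i i := by
  choose d hd hdA using fun i => RCLike.pos_iff_exists_ofReal.mp (hA.diag_pos (i := i))
  let D : Matrix n n 𝕜 := diagonal fun i => (((√(d i))⁻¹ : ℝ) : 𝕜)
  have hDH : Dᴴ = D := by
    simp [D, diagonal_conjTranspose, Pi.star_def]
  have hD : IsUnit D := by
    rw [isUnit_iff_isUnit_det, isUnit_iff_ne_zero]
    simp [D, Finset.prod_ne_zero_iff, Real.sqrt_ne_zero', hd]
  have hB : (D * A * D).PosDef := by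
    have := (IsUnit.posDef_star_left_conjugate_iff hD).mpr hA
    rwa [star_eq_conjTranspose, hDH] at this
  have hdiag : ∀ i, (D * A * D) i i = 1 := fun i => by
    have : (√(d i))⁻¹ * d i * (√(d i))⁻¹ = 1 := by
      have := Real.sqrt_ne_zero'.mpr (hd i)
      field_simp
      exact (Real.sq_sqrt (hd i).le).symm
    simp only [D, mul_diagonal, diagonal_mul, ← hdA i]
    exact_mod_cast this
  have hscale : A.det = (∏ i, A i i) * (D * A * D).det := by
    have : (∏ i, A i i) * (D.det * D.det) = 1 := by
      simp only [D, det_diagonal, ← Finset.prod_mul_distrib]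
      refine Finset.prod_eq_one fun i _ => ?_
      rw [← hdiag i]
      simp only [D, mul_diagonal, diagonal_mul]
      ring
    rw [det_mul, det_mul]
    linear_combination (-A.det) * this
  rw [hscale]
  exact mul_le_of_le_one_right (Finset.prod_nonneg fun i _ => hA.diag_pos.le)
    (hB.det_le_one_of_diag_eq_one hdiag)

/-- Hadamard-style bound: for a diagonal `W = diag(g)` with `g i ≥ 0` and a
Hermitian positive semidefinite `R` with diagonal entries `p i = R i i` (real and
nonnegative), the determinant `det (I + W R)` is real and satisfies
`det (I + W R) ≤ ∏ i, (1 + g i * p i) = det (I + W * diag p)`. -/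
theorem stmt_1
    (m : ℕ) (g : Fin m → ℝ) (hg : ∀ i, 0 ≤ g i)
    (R : Matrix (Fin m) (Fin m) ℂ) (hR : R.PosSemidef)
    (W : Matrix (Fin m) (Fin m) ℂ)
    (hW : W = Matrix.diagonal (fun i => (g i : ℂ))) :
    (Matrix.det (1 + W * R)).im = 0 ∧
    (Matrix.det (1 + W * R)).re ≤ ∏ i, (1 + g i * (R i i).re) ∧
    ((∏ i, (1 + g i * (R i i).re) : ℝ) : ℂ)
      = Matrix.det (1 + W * Matrix.diagonal (fun i => R i i)) := by
  have hp : ∀ i, ((R i i).re : ℂ) = R i i := fun i => hR.isHermitian.coe_re_apply_self i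
  have hprod : ((∏ i, (1 + g i * (R i i).re) : ℝ) : ℂ) = ∏ i, (1 + (g i : ℂ) * R i i) := by
    push_cast
    simp only [hp]
  let S : Matrix (Fin m) (Fin m) ℂ := diagonal fun i => ((√(g i) : ℝ) : ℂ)
  have hSH : Sᴴ = S := by
    simp [S, diagonal_conjTranspose, Pi.star_def]
  have hsq : ∀ i, ((√(g i) : ℝ) : ℂ) * ((√(g i) : ℝ) : ℂ) = g i := fun i => by
    exact_mod_cast Real.mul_self_sqrt (hg i)
  have hWS : W = S * S := by
    simp only [hW, S, diagonal_mul_diagonal, hsq]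
  have hdet : (1 + W * R).det = (1 + S * R * S).det := by
    rw [hWS, mul_assoc, det_one_add_mul_comm]
  have hA : (1 + S * R * S).PosDef := by
    have := hR.conjTranspose_mul_mul_same S
    rw [hSH] at this
    exact PosDef.one.add_posSemidef this
  have hle : (1 + W * R).det ≤ ((∏ i, (1 + g i * (R i i).re) : ℝ) : ℂ) := by
    rw [hdet, hprod]
    refine hA.det_le_prod_diag.trans_eq (Finset.prod_congr rfl fun i _ => ?_)
    simp only [S, Matrix.add_apply, one_apply_eq, mul_diagonal, diagonal_mul, ← hsq i]
    ring
  obtain ⟨hre, him⟩ := Complex.le_def.mp hle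
  refine ⟨him.trans (Complex.ofReal_im _), hre, ?_⟩
  rw [hprod, hW, diagonal_mul_diagonal, ← diagonal_one, diagonal_add, det_diagonal]
end

section
/- Fix g_1,…,g_m > 0, a partition of {1,…,m} into disjoint nonempty groups I(1),…,I(s), P_T > 0 and P_1,…,P_s > 0. Let μ > 0 and λ_1,…,λ_s ≥ 0, and for i ∈ I(j) define p_i = ((μ+λ_j)^{-1} − g_i^{-1})_+. Assume ∑_{i=1}^m p_i = P_T, ∑_{i∈I(j)} p_i ≤ P_j for every j, and λ_j·(∑_{i∈I(j)} p_i − P_j) = 0 for every j. Then for every j, ∑_{i∈I(j)} p_i = min{ P_j, ∑_{i∈I(j)} (μ^{-1} − g_i^{-1})_+ }, and consequently μ satisfies ∑_{j=1}^s min{ P_j, ∑_{i∈I(j)} (μ^{-1} − g_i^{-1})_+ } = P_T. -/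
open Finset

/-- Characterization of the group sums and of the dual variable `μ` for the
water-filling solution under joint total and per-group power constraints.  The antennas are
partitioned into `s` disjoint nonempty groups via the surjective map `grp : Fin m → Fin s`.
If `μ > 0`, `λ j ≥ 0`, `p_i = ((μ + λ_{grp i})⁻¹ - g_i⁻¹)_+` exhausts the total power, each
group budget is respected, and complementary slackness holds for each group, then each group
sum equals `min (P j) (∑_{i ∈ I(j)} (μ⁻¹ - g_i⁻¹)_+)`, and consequently
`∑ j, min (P j) (∑_{i ∈ I(j)} (μ⁻¹ - g_i⁻¹)_+) = P_T`. -/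
theorem stmt_2
    (m s : ℕ)
    (g : Fin m → ℝ) (hg : ∀ i, 0 < g i)
    (grp : Fin m → Fin s) (hgrp : Function.Surjective grp)
    (PT : ℝ) (hPT : 0 < PT)
    (P : Fin s → ℝ) (hP : ∀ j, 0 < P j)
    (μ : ℝ) (hμ : 0 < μ)
    (lam : Fin s → ℝ) (hlam : ∀ j, 0 ≤ lam j)
    (p : Fin m → ℝ)
    (hp : ∀ i, p i = max ((μ + lam (grp i))⁻¹ - (g i)⁻¹) 0)
    (hTPC : ∑ i, p i = PT)
    (hPGPC : ∀ j, ∑ i ∈ univ.filter (fun i => grp i = j), p i ≤ P j)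
    (hslack : ∀ j, lam j * ((∑ i ∈ univ.filter (fun i => grp i = j), p i) - P j) = 0) :
    (∀ j, ∑ i ∈ univ.filter (fun i => grp i = j), p i
        = min (P j) (∑ i ∈ univ.filter (fun i => grp i = j), max (μ⁻¹ - (g i)⁻¹) 0)) ∧
    ∑ j, min (P j) (∑ i ∈ univ.filter (fun i => grp i = j), max (μ⁻¹ - (g i)⁻¹) 0) = PT := by
  have hgroup : ∀ j, ∑ i ∈ univ.filter (fun i => grp i = j), p i
      = min (P j) (∑ i ∈ univ.filter (fun i => grp i = j), max (μ⁻¹ - (g i)⁻¹) 0) := by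
    intro j
    have hle : ∑ i ∈ univ.filter (fun i => grp i = j), p i
        ≤ ∑ i ∈ univ.filter (fun i => grp i = j), max (μ⁻¹ - (g i)⁻¹) 0 := by
      refine sum_le_sum fun i _ => ?_
      rw [hp i]
      have hinv : (μ + lam (grp i))⁻¹ ≤ μ⁻¹ :=
        inv_anti₀ hμ (le_add_of_nonneg_right (hlam _))
      exact max_le_max (sub_le_sub_right hinv _) le_rfl
    rcases mul_eq_zero.mp (hslack j) with h | h
    · have heq : ∑ i ∈ univ.filter (fun i => grp i = j), p i
          = ∑ i ∈ univ.filter (fun i => grp i = j), max (μ⁻¹ - (g i)⁻¹) 0 := by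
        refine sum_congr rfl fun i hi => ?_
        rw [hp i, (mem_filter.mp hi).2, h, add_zero]
      rw [← heq, min_eq_right (hPGPC j)]
    · rw [sub_eq_zero] at h
      rw [min_eq_left (h ▸ hle), h]
  refine ⟨hgroup, ?_⟩
  rw [← hTPC, ← sum_fiberwise univ grp p]
  exact sum_congr rfl fun j _ => (hgroup j).symm
end

section
/- Fix a partition of {1,…,m} into disjoint nonempty groups I(1),…,I(s), P_T > 0 and P_1,…,P_s > 0. Suppose there is a subset A ⊆ {1,…,s} of 'active' groups with ∑_{j∈A} |I(j)| < m and ∑_{j∈A} P_j ≤ P_T, and set r = (P_T − ∑_{j∈A} P_j) / (m − ∑_{j∈A} |I(j)|); assume P_j/|I(j)| ≤ r for every j ∈ A and r ≤ P_j/|I(j)| for every j ∉ A. Define p* ∈ ℝ^m by p*_i = P_j/|I(j)| for i ∈ I(j) with j ∈ A, and p*_i = r for i ∈ I(j) with j ∉ A. Then p* ∈ S_P, and for every function f: ℝ^m → ℝ that is symmetric (invariant under permutations of its arguments), concave, and nondecreasing in each coordinate, and every p ∈ S_P, one has f(p) ≤ f(p*). In particular p* is the optimal power allocation produced by the per-group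 water-leveling algorithm. -/
open Finset

/-- Moving an amount `t` from a larger coordinate `i` to a smaller coordinate `k`, without
overshooting, does not decrease a symmetric concave function. -/
theorem ConcaveOn.le_update_transfer {ι : Type*} [DecidableEq ι] {f : (ι → ℝ) → ℝ}
    (hsymm : ∀ σ : Equiv.Perm ι, ∀ p : ι → ℝ, f (p ∘ σ) = f p)
    (hf : ConcaveOn ℝ Set.univ f) (q : ι → ℝ) {i k : ι} {t : ℝ}
    (ht : 0 ≤ t) (hlt : q k < q i) (htr : t ≤ q i - q k) :
    f q ≤ f (Function.update (Function.update q i (q i - t)) k (q k + t)) := by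
  have hpos : 0 < q i - q k := by linarith
  have hik : i ≠ k := by rintro rfl; exact lt_irrefl _ hlt
  set θ := t / (q i - q k) with hθ
  have hθt : θ * (q i - q k) = t := div_mul_cancel₀ _ hpos.ne'
  have h := hf.2 (Set.mem_univ q) (Set.mem_univ (q ∘ Equiv.swap i k))
    (sub_nonneg.2 ((div_le_one hpos).2 htr)) (div_nonneg ht hpos.le) (sub_add_cancel 1 θ)
  rw [← hθ] at h
  have hcomb : (1 - θ) • q + θ • (q ∘ Equiv.swap i k) =
      Function.update (Function.update q i (q i - t)) k (q k + t) := by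
    funext l
    by_cases hlk : l = k
    · subst hlk
      simp only [Pi.add_apply, Pi.smul_apply, smul_eq_mul, Function.comp_apply,
        Equiv.swap_apply_right, Function.update_self]
      linarith
    · by_cases hli : l = i
      · subst hli
        simp only [Pi.add_apply, Pi.smul_apply, smul_eq_mul, Function.comp_apply,
          Equiv.swap_apply_left, Function.update_self, Function.update_of_ne hlk]
        linarith
      · simp only [Pi.add_apply, Pi.smul_apply, smul_eq_mul, Function.comp_apply,
          Equiv.swap_apply_of_ne_of_ne hli hlk, Function.update_of_ne hlk,
          Function.update_of_ne hli]
        ring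
  rw [hcomb, hsymm, smul_eq_mul, smul_eq_mul] at h
  linarith

/-- If on every sublevel set of `p` the total of `q` is at most the total of `p`, then every
symmetric concave nondecreasing function is at least as large at `p` as at `q`. -/
theorem ConcaveOn.le_of_sum_sublevel_le {ι : Type*} [Fintype ι] {f : (ι → ℝ) → ℝ}
    (hsymm : ∀ σ : Equiv.Perm ι, ∀ p : ι → ℝ, f (p ∘ σ) = f p)
    (hf : ConcaveOn ℝ Set.univ f) (hmono : Monotone f) (p q : ι → ℝ)
    (hle : ∀ c, ∑ i with p i ≤ c, q i ≤ ∑ i with p i ≤ c, p i) :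
    f q ≤ f p := by
  classical
  induction hn : #{i | q i ≠ p i} using Nat.strong_induction_on generalizing q with
  | _ n ih =>
    by_cases hqp : ∀ i, q i ≤ p i
    · exact hmono hqp
    push Not at hqp
    obtain ⟨i, hi, himin⟩ := exists_min_image ({i | p i < q i} : Finset ι) p
      (hqp.imp fun i hi => by simpa using hi)
    simp only [mem_filter, mem_univ, true_and] at hi himin
    obtain ⟨k, hki, hk⟩ : ∃ k, p k ≤ p i ∧ q k < p k := by
      by_contra! hno
      exact (hle (p i)).not_gt (sum_lt_sum (fun k hk => hno k (by simpa using hk))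
        ⟨i, by simp, hi⟩)
    have hik : i ≠ k := by rintro rfl; exact lt_asymm hi hk
    set t := min (q i - p i) (p k - q k) with ht
    have ht₁ : t ≤ q i - p i := min_le_left _ _
    have ht₂ : t ≤ p k - q k := min_le_right _ _
    have ht₀ : 0 < t := lt_min (by linarith) (by linarith)
    set q' := Function.update (Function.update q i (q i - t)) k (q k + t) with hq'
    have hqk : q' k = q k + t := Function.update_self ..
    have hqi : q' i = q i - t := by
      rw [hq', Function.update_of_ne hik, Function.update_self]
    have hql : ∀ l, l ≠ i → l ≠ k → q' l = q l := fun l hli hlk => by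
      rw [hq', Function.update_of_ne hlk, Function.update_of_ne hli]
    refine (hf.le_update_transfer hsymm q ht₀.le (by linarith) (by linarith)).trans
      (ih #{l | q' l ≠ p l} ?_ q' ?_ rfl)
    · rw [← hn]
      apply card_lt_card
      have hsub : ({l | q' l ≠ p l} : Finset ι) ⊆ ({l | q l ≠ p l} : Finset ι) := by
        intro l hl
        simp only [mem_filter, mem_univ, true_and] at hl ⊢
        by_cases hli : l = i
        · exact hli ▸ hi.ne'
        by_cases hlk : l = k
        · exact hlk ▸ hk.ne
        rwa [← hql l hli hlk]
      refine (ssubset_iff_of_subset hsub).2 ?_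
      rcases min_choice (q i - p i) (p k - q k) with h | h
      · exact ⟨i, by simpa using hi.ne', by simp [hqi, ht, h]⟩
      · exact ⟨k, by simpa using hk.ne, by simp [hqk, ht, h]⟩
    · intro c
      by_cases hc : p i ≤ c
      · refine le_of_eq_of_le ?_ (hle c)
        have hi_mem : i ∈ ({l | p l ≤ c} : Finset ι) := by simpa using hc
        have hk_mem : k ∈ ({l | p l ≤ c} : Finset ι) := by simpa using hki.trans hc
        rw [hq', sum_update_of_mem hk_mem, sum_update_of_mem (by simp [hc, hik]),
          ← add_sum_erase _ q hk_mem, ← add_sum_erase _ q (mem_erase.2 ⟨hik, hi_mem⟩),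
          sdiff_singleton_eq_erase, sdiff_singleton_eq_erase]
        ring
      · refine sum_le_sum fun l hl => ?_
        simp only [mem_filter, mem_univ, true_and] at hl
        have hli : l ≠ i := by rintro rfl; exact hc hl
        by_cases hlk : l = k
        · subst hlk
          linarith
        rw [hql l hli hlk]
        by_contra! h
        exact hc ((himin l h).trans hl)

/-- Optimality of the per-group water-leveling allocation for the i.i.d.
fading orthogonal channel.  The antennas `{0, …, m-1}` are partitioned into `s` disjoint
nonempty groups via the surjective map `grp : Fin m → Fin s` (group `I(j)` is the fiber of
`j`).  Given a set `A` of "active" groups whose sizes do not exhaust all antennas and whose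
budgets do not exhaust the total power, with level
`r = (P_T - ∑_{j ∈ A} P_j) / (m - ∑_{j ∈ A} |I(j)|)` satisfying `P_j/|I(j)| ≤ r` for active
groups and `r ≤ P_j/|I(j)|` for the other groups, the allocation giving `P_j/|I(j)|` to each
antenna of an active group `j` and `r` to every other antenna is feasible and maximizes every
symmetric concave coordinatewise-nondecreasing function over the feasible set. -/
theorem stmt_5
    (m s : ℕ)
    (grp : Fin m → Fin s) (hgrp : Function.Surjective grp)
    (PT : ℝ) (hPT : 0 < PT)
    (P : Fin s → ℝ) (hP : ∀ j, 0 < P j)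
    (A : Finset (Fin s))
    (hcard : ∑ j ∈ A, (univ.filter (fun i => grp i = j)).card < m)
    (hpow : ∑ j ∈ A, P j ≤ PT)
    (r : ℝ)
    (hr : r = (PT - ∑ j ∈ A, P j) /
        ((m : ℝ) - (∑ j ∈ A, (univ.filter (fun i => grp i = j)).card : ℕ)))
    (hA : ∀ j ∈ A, P j / ((univ.filter (fun i => grp i = j)).card : ℝ) ≤ r)
    (hnA : ∀ j ∉ A, r ≤ P j / ((univ.filter (fun i => grp i = j)).card : ℝ))
    (pstar : Fin m → ℝ)
    (hpstar : ∀ i, pstar i =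
        if grp i ∈ A then P (grp i) / ((univ.filter (fun i' => grp i' = grp i)).card : ℝ)
        else r) :
    -- `p*` is feasible
    ((∀ i, 0 ≤ pstar i) ∧ (∑ i, pstar i ≤ PT) ∧
      (∀ j, ∑ i ∈ univ.filter (fun i => grp i = j), pstar i ≤ P j)) ∧
    -- `p*` maximizes every symmetric concave nondecreasing function over the feasible set
    (∀ f : (Fin m → ℝ) → ℝ,
      (∀ σ : Equiv.Perm (Fin m), ∀ p : Fin m → ℝ, f (p ∘ σ) = f p) →
      ConcaveOn ℝ Set.univ f →
      Monotone f →
      ∀ p : Fin m → ℝ, (∀ i, 0 ≤ p i) → (∑ i, p i ≤ PT) →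
        (∀ j, ∑ i ∈ univ.filter (fun i => grp i = j), p i ≤ P j) →
        f p ≤ f pstar) := by
  have hn : ∀ j, 0 < (#{i | grp i = j} : ℝ) := fun j => by
    obtain ⟨i, hi⟩ := hgrp j
    exact_mod_cast card_pos.2 ⟨i, by simpa using hi⟩
  have hfiber : ∀ j, ∑ i with grp i = j, pstar i =
      #{i | grp i = j} * if j ∈ A then P j / (#{i | grp i = j} : ℝ) else r := fun j => by
    rw [← nsmul_eq_mul, ← sum_const]
    refine sum_congr rfl fun i hi => ?_
    obtain rfl : grp i = j := by simpa using hi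
    exact hpstar i
  have hfiberA : ∀ j ∈ A, ∑ i with grp i = j, pstar i = P j := fun j hj => by
    rw [hfiber, if_pos hj, mul_div_cancel₀ _ (hn j).ne']
  have hfiberA' : ∀ j ∉ A, ∑ i with grp i = j, pstar i = #{i | grp i = j} * r :=
    fun j hj => by rw [hfiber, if_neg hj]
  have hden : 0 < (m : ℝ) - (∑ j ∈ A, #{i | grp i = j} : ℕ) :=
    sub_pos.2 (by exact_mod_cast hcard)
  have hr₀ : 0 ≤ r := hr ▸ div_nonneg (sub_nonneg.2 hpow) hden.le
  have hm : ∑ j, (#{i | grp i = j} : ℝ) = m := by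
    have h := card_eq_sum_card_fiberwise (f := grp) (s := univ) (t := univ) (by simp)
    rw [card_univ, Fintype.card_fin] at h
    exact_mod_cast h.symm
  have hsum : ∑ i, pstar i = PT := by
    rw [← sum_fiberwise univ grp pstar, ← sum_add_sum_compl A, sum_congr rfl hfiberA,
      sum_congr rfl fun j hj => hfiberA' j (mem_compl.1 hj), ← sum_mul]
    have hcompl := sum_add_sum_compl A fun j => (#{i | grp i = j} : ℝ)
    rw [hm] at hcompl
    rw [eq_div_iff hden.ne', Nat.cast_sum, ← hcompl, add_sub_cancel_left] at hr
    linarith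
  have hle : ∀ i, pstar i ≤ r := fun i => by
    rw [hpstar]
    split_ifs with h
    exacts [hA _ h, le_rfl]
  refine ⟨⟨fun i => ?_, hsum.le, fun j => ?_⟩, fun f hsymm hf hmono p _ hpT hpP => ?_⟩
  · rw [hpstar]
    split_ifs
    exacts [div_nonneg (hP _).le (hn _).le, hr₀]
  · by_cases hj : j ∈ A
    · exact (hfiberA j hj).le
    · rw [hfiberA' j hj, mul_comm]
      exact (le_div_iff₀ (hn j)).1 (hnA j hj)
  · refine hf.le_of_sum_sublevel_le hsymm hmono pstar p fun c => ?_
    by_cases hc : r ≤ c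
    · rw [filter_true_of_mem fun i _ => (hle i).trans hc, hsum]
      exact hpT
    rw [← sum_fiberwise _ grp p, ← sum_fiberwise _ grp pstar]
    refine sum_le_sum fun j _ => ?_
    rw [filter_filter]
    by_cases hj : j ∈ A ∧ P j / (#{i | grp i = j} : ℝ) ≤ c
    · have hset : ({i | pstar i ≤ c ∧ grp i = j} : Finset (Fin m)) =
          ({i | grp i = j} : Finset (Fin m)) := by
        refine filter_congr fun i _ => and_iff_right_of_imp ?_
        rintro rfl
        rw [hpstar, if_pos hj.1]
        exact hj.2
      rw [hset, hfiberA j hj.1]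
      exact hpP j
    · have hset : ({i | pstar i ≤ c ∧ grp i = j} : Finset (Fin m)) = ∅ := by
        refine filter_false_of_mem fun i _ => ?_
        rintro ⟨hi, rfl⟩
        rw [hpstar] at hi
        split_ifs at hi with h
        exacts [hj ⟨h, hi⟩, hc hi]
      rw [hset, sum_empty, sum_empty]
end

section
/- Let m > q ≥ 1 be integers, let x ∈ ℝ, let x_{q+1} ≥ x_{q+2} ≥ … ≥ x_m be real numbers with x ≥ x_{q+1}, and let ε_{q+1},…,ε_m ≥ 0. Define the vectors x¹ = (x,…,x, x_{q+1},…,x_m) ∈ ℝ^m (with q copies of x) and x² ∈ ℝ^m whose first q entries all equal x + (1/q)·∑_{i=q+1}^m ε_i and whose remaining m−q entries are x_{q+1}−ε_{q+1},…,x_m−ε_m. Then x¹ is majorized by x². -/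
open Finset

/-- `x` is majorized by `y`: after rearranging both vectors in decreasing order (via
permutations `σ`, `τ`), every initial partial sum of `x` is at most the corresponding partial
sum of `y`, and the total sums agree. -/
def IsMajorizedBy {m : ℕ} (x y : Fin m → ℝ) : Prop :=
  ∃ σ τ : Equiv.Perm (Fin m), Antitone (x ∘ σ) ∧ Antitone (y ∘ τ) ∧
    (∀ k : Fin m, ∑ i ∈ univ.filter (· ≤ k), x (σ i) ≤ ∑ i ∈ univ.filter (· ≤ k), y (τ i)) ∧
    (∑ i, x i = ∑ i, y i)

/-- The sum of an antitone vector over an initial segment is the largest among the sums over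
index sets of the same size. -/
theorem Antitone.sum_le_sum_filter_le {m : ℕ} {f : Fin m → ℝ} (hf : Antitone f) (k : Fin m)
    (s : Finset (Fin m)) (hs : s.card = (univ.filter (· ≤ k)).card) :
    ∑ i ∈ s, f i ≤ ∑ i ∈ univ.filter (· ≤ k), f i := by
  have key : ∑ i ∈ s, (f i - f k) ≤ ∑ i ∈ univ.filter (· ≤ k), (f i - f k) := by
    rw [← sum_filter_add_sum_filter_not s (· ≤ k)]
    have h_tail : ∑ i ∈ s.filter (fun i => ¬ i ≤ k), (f i - f k) ≤ 0 :=
      sum_nonpos fun i hi => sub_nonpos.2 (hf (not_le.1 (mem_filter.1 hi).2).le)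
    have h_head : ∑ i ∈ s.filter (· ≤ k), (f i - f k) ≤
        ∑ i ∈ univ.filter (· ≤ k), (f i - f k) :=
      sum_le_sum_of_subset_of_nonneg (filter_subset_filter _ (subset_univ s))
        fun i hi _ => sub_nonneg.2 (hf (mem_filter.1 hi).2)
    linarith
  simp only [sum_sub_distrib, sum_const, hs] at key
  linarith

/-- An antitone vector is majorized by any vector with the same total whose initial partial sums,
in the given order, dominate. -/
theorem IsMajorizedBy.of_antitone {m : ℕ} {x y : Fin m → ℝ} (hx : Antitone x)
    (hle : ∀ k, ∑ i ∈ univ.filter (· ≤ k), x i ≤ ∑ i ∈ univ.filter (· ≤ k), y i)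
    (hsum : ∑ i, x i = ∑ i, y i) : IsMajorizedBy x y := by
  have hτ : Antitone (y ∘ Tuple.sort fun i => -y i) := fun i j hij =>
    neg_le_neg_iff.1 (Tuple.monotone_sort (fun i => -y i) hij)
  refine ⟨Equiv.refl _, Tuple.sort fun i => -y i, hx, hτ, fun k => (hle k).trans ?_, hsum⟩
  generalize (Tuple.sort fun i => -y i) = τ at hτ ⊢
  have h := hτ.sum_le_sum_filter_le k ((univ.filter (· ≤ k)).map τ.symm.toEmbedding) (card_map _)
  simpa [sum_map] using h

/-- If a vector of total zero is nonnegative before the index `q` and nonpositive from it on, then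
its initial partial sums are nonnegative. -/
theorem sum_filter_le_nonneg_of_sign_change {m : ℕ} (q : ℕ) {d : Fin m → ℝ}
    (hpos : ∀ i : Fin m, (i : ℕ) < q → 0 ≤ d i) (hneg : ∀ i : Fin m, q ≤ (i : ℕ) → d i ≤ 0)
    (hsum : ∑ i, d i = 0) (k : Fin m) : 0 ≤ ∑ i ∈ univ.filter (· ≤ k), d i := by
  rcases lt_or_ge (k : ℕ) q with hk | hk
  · exact sum_nonneg fun i hi => hpos i (lt_of_le_of_lt (mem_filter.1 hi).2 hk)
  · have h_tail : ∑ i ∈ univ.filter (fun i => ¬ i ≤ k), d i ≤ 0 :=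
      sum_nonpos fun i hi => hneg i (hk.trans (not_le.1 (mem_filter.1 hi).2).le)
    have h_split := sum_filter_add_sum_filter_not univ (· ≤ k) d
    linarith

/-- The majorization step in the proof of optimality of the water-leveling
allocation.  Let `m > q ≥ 1`, let `x ∈ ℝ`, let the entries `xv i` for indices `i ≥ q` be
arranged in decreasing order with `x ≥ xv i`, and let `ε i ≥ 0`.  Then the vector
`x¹ = (x, …, x, xv q, …, xv (m-1))` (with `q` copies of `x`) is majorized by the vector `x²`
whose first `q` entries all equal `x + (1/q) ∑_{i ≥ q} ε i` and whose remaining entries are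
`xv i - ε i` for `i ≥ q`. -/
theorem stmt_7
    (m q : ℕ) (hq : 1 ≤ q) (hqm : q < m)
    (x : ℝ) (xv : Fin m → ℝ) (eps : Fin m → ℝ)
    (hdec : ∀ i j : Fin m, q ≤ (i : ℕ) → i ≤ j → xv j ≤ xv i)
    (hx : ∀ i : Fin m, q ≤ (i : ℕ) → xv i ≤ x)
    (heps : ∀ i : Fin m, 0 ≤ eps i)
    (x1 x2 : Fin m → ℝ)
    (hx1 : ∀ i : Fin m, x1 i = if (i : ℕ) < q then x else xv i)
    (hx2 : ∀ i : Fin m, x2 i =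
        if (i : ℕ) < q then
          x + (1 / (q : ℝ)) * ∑ i' ∈ univ.filter (fun i' : Fin m => q ≤ (i' : ℕ)), eps i'
        else xv i - eps i) :
    IsMajorizedBy x1 x2 := by
  have hq0 : (0 : ℝ) < q := by exact_mod_cast hq
  set S := ∑ i' ∈ univ.filter (fun i' : Fin m => q ≤ (i' : ℕ)), eps i' with hS
  have hS0 : 0 ≤ S := sum_nonneg fun i _ => heps i
  have hd : ∀ i, x2 i - x1 i = if (i : ℕ) < q then 1 / (q : ℝ) * S else -eps i := by
    intro i
    rw [hx1, hx2]
    split_ifs <;> ring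
  have hcard : (univ.filter fun i : Fin m => (i : ℕ) < q).card = q := by
    rw [Fin.card_filter_val_lt, min_eq_right hqm.le]
  have hsum : ∑ i, (x2 i - x1 i) = 0 := by
    simp only [hd, sum_ite, sum_const, hcard, not_lt, sum_neg_distrib, ← hS, nsmul_eq_mul]
    field_simp
    ring
  refine .of_antitone ?_ (fun k => ?_) ?_
  · intro i j hij
    have hij' : (i : ℕ) ≤ j := hij
    rw [hx1, hx1]
    split_ifs with hj hi hi
    · exact le_rfl
    · omega
    · exact hx j (not_lt.1 hj)
    · exact hdec i j (not_lt.1 hi) hij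
  · rw [← sub_nonneg, ← sum_sub_distrib]
    refine sum_filter_le_nonneg_of_sign_change q (fun i hi => ?_) (fun i hi => ?_) hsum k
    · rw [hd, if_pos hi]
      positivity
    · rw [hd, if_neg hi.not_gt]
      exact neg_nonpos.2 (heps i)
  · rw [sum_sub_distrib] at hsum
    linarith
end

section
/- Let W be a random 2×2 complex matrix on a probability space such that W is almost surely Hermitian positive semidefinite and the law of W equals the law of the matrix W̃ obtained from W by negating both off-diagonal entries. Let R be a (deterministic) 2×2 complex Hermitian positive semidefinite matrix, and assume that ω ↦ ln det(I + W(ω)·R) and ω ↦ ln det(I + W(ω)·diag(R_{11}, R_{22})) are integrable (both determinants are real and ≥ 1). Then E[ ln det(I + W·R) ] ≤ E[ ln det(I + W·diag(R_{11}, R_{22})) ]; that is, replacing R by the diagonal matrix with the same diagonal does not decrease the expected log-determinant. -/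
open Matrix ComplexOrder MeasureTheory

/-- Matrices over a measurable space carry the product measurable structure. -/
instance matrixMeasurableSpace {m n α : Type*} [MeasurableSpace α] :
    MeasurableSpace (Matrix m n α) :=
  inferInstanceAs (MeasurableSpace (m → n → α))

/-- Negate the off-diagonal entries of a matrix. -/
def negOffDiag (M : Matrix (Fin 2) (Fin 2) ℂ) : Matrix (Fin 2) (Fin 2) ℂ :=
  Matrix.of fun i j => if i = j then M i j else -(M i j)

lemma measurable_matrix_entry (i j : Fin 2) :
    Measurable fun M : Matrix (Fin 2) (Fin 2) ℂ => M i j :=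
  (measurable_pi_apply j).comp (measurable_pi_apply (X := fun _ : Fin 2 => Fin 2 → ℂ) i)

lemma measurable_negOffDiag : Measurable negOffDiag := by
  refine measurable_pi_lambda (X := fun _ : Fin 2 => Fin 2 → ℂ) _
    fun i => measurable_pi_lambda _ fun j => ?_
  by_cases h : i = j
  · simpa [negOffDiag, h] using measurable_matrix_entry j j
  · simp only [negOffDiag, Matrix.of_apply, if_neg h]
    exact (measurable_matrix_entry i j).neg

lemma measurable_log_det_one_add_mul (R : Matrix (Fin 2) (Fin 2) ℂ) :
    Measurable fun M : Matrix (Fin 2) (Fin 2) ℂ => Real.log (Matrix.det (1 + M * R)).re := by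
  have h := measurable_matrix_entry
  refine Real.measurable_log.comp (Complex.measurable_re.comp ?_)
  simp only [Matrix.det_fin_two, Matrix.add_apply, Matrix.mul_apply, Fin.sum_univ_two]
  have h00 := h 0 0
  have h01 := h 0 1
  have h10 := h 1 0
  have h11 := h 1 1
  fun_prop

/-- Entrywise description of a positive semidefinite 2×2 complex matrix. -/
lemma Matrix.PosSemidef.entries_fin_two {M : Matrix (Fin 2) (Fin 2) ℂ} (hM : M.PosSemidef) :
    ∃ (a d x y : ℝ), 0 ≤ a ∧ 0 ≤ d ∧ x ^ 2 + y ^ 2 ≤ a * d ∧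
      M = !![(a : ℂ), ⟨x, y⟩; ⟨x, -y⟩, (d : ℂ)] := by
  have h0 := Complex.nonneg_iff.1 (hM.diag_nonneg (i := 0))
  have h1 := Complex.nonneg_iff.1 (hM.diag_nonneg (i := 1))
  have hdet := (Complex.nonneg_iff.1 hM.det_nonneg).1
  have hH : star (M 0 1) = M 1 0 := hM.isHermitian.apply 1 0
  refine ⟨(M 0 0).re, (M 1 1).re, (M 0 1).re, (M 0 1).im, h0.1, h1.1, ?_, ?_⟩
  · rw [Matrix.det_fin_two, ← hH] at hdet
    simp [← h0.2, ← h1.2] at hdet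
    nlinarith
  · ext i j
    fin_cases i <;> fin_cases j
    · exact Complex.ext rfl h0.2.symm
    · rfl
    · exact hH.symm
    · exact Complex.ext rfl h1.2.symm

lemma log_add_log_le_of_psd_entries {a d x y p s u v : ℝ} (ha : 0 ≤ a) (hd : 0 ≤ d)
    (hxy : x ^ 2 + y ^ 2 ≤ a * d) (hp : 0 ≤ p) (hs : 0 ≤ s) (huv : u ^ 2 + v ^ 2 ≤ p * s) :
    Real.log (1 + a * p + d * s + (a * d - (x ^ 2 + y ^ 2)) * (p * s - (u ^ 2 + v ^ 2))
        + 2 * (x * u + y * v))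
      + Real.log (1 + a * p + d * s + (a * d - (x ^ 2 + y ^ 2)) * (p * s - (u ^ 2 + v ^ 2))
        - 2 * (x * u + y * v))
      ≤ 2 * Real.log (1 + a * p + d * s + (a * d - (x ^ 2 + y ^ 2)) * (p * s)) := by
  have hap := mul_nonneg ha hp
  have hds := mul_nonneg hd hs
  have hdets := mul_nonneg (sub_nonneg.2 hxy) (sub_nonneg.2 huv)
  have hprod : (x ^ 2 + y ^ 2) * (u ^ 2 + v ^ 2) ≤ (a * d) * (p * s) :=
    mul_le_mul hxy huv (by positivity) (by positivity)
  have ht : |2 * (x * u + y * v)| ≤ a * p + d * s := by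
    apply abs_le_of_sq_le_sq _ (by positivity)
    nlinarith [sq_nonneg (x * v - y * u), sq_nonneg (a * p - d * s)]
  obtain ⟨ht1, ht2⟩ := abs_le.1 ht
  have hle : (a * d - (x ^ 2 + y ^ 2)) * (p * s - (u ^ 2 + v ^ 2))
      ≤ (a * d - (x ^ 2 + y ^ 2)) * (p * s) :=
    mul_le_mul_of_nonneg_left (by nlinarith [sq_nonneg u, sq_nonneg v]) (sub_nonneg.2 hxy)
  generalize (a * d - (x ^ 2 + y ^ 2)) * (p * s - (u ^ 2 + v ^ 2)) = c at *
  generalize (a * d - (x ^ 2 + y ^ 2)) * (p * s) = e at *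
  generalize 2 * (x * u + y * v) = t at *
  rw [← Real.log_mul (by linarith) (by linarith), ← Nat.cast_ofNat (n := 2), ← Real.log_pow]
  refine Real.log_le_log (mul_pos (by linarith) (by linarith)) ?_
  have hsq : (1 + a * p + d * s + c) ^ 2 ≤ (1 + a * p + d * s + e) ^ 2 :=
    pow_le_pow_left₀ (by linarith) (by linarith) 2
  nlinarith [sq_nonneg t]

lemma log_det_add_log_det_negOffDiag_le {M R : Matrix (Fin 2) (Fin 2) ℂ}
    (hM : M.PosSemidef) (hR : R.PosSemidef) :
    Real.log (Matrix.det (1 + M * R)).re + Real.log (Matrix.det (1 + negOffDiag M * R)).re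
      ≤ 2 * Real.log (Matrix.det (1 + M * Matrix.diagonal (fun i => R i i))).re := by
  obtain ⟨a, d, x, y, ha, hd, hxy, rfl⟩ := hM.entries_fin_two
  obtain ⟨p, s, u, v, hp, hs, huv, rfl⟩ := hR.entries_fin_two
  convert log_add_log_le_of_psd_entries ha hd hxy hp hs huv using 3
  all_goals
    simp only [Matrix.det_fin_two, Matrix.add_apply, Matrix.mul_apply, Fin.sum_univ_two]
    simp [negOffDiag]
    ring

/-- Let `W` be a random 2×2 complex matrix, a.s. Hermitian positive
semidefinite, whose law is invariant under negating both off-diagonal entries, and let `R` be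
a deterministic 2×2 Hermitian positive semidefinite matrix.  Assuming integrability of the
log-determinants, replacing `R` by the diagonal matrix with the same diagonal does not
decrease the expected log-determinant:
`E[ln det (I + W R)] ≤ E[ln det (I + W diag(R₀₀, R₁₁))]`. -/
theorem stmt_11
    {Ω : Type*} [MeasurableSpace Ω] (μ : MeasureTheory.Measure Ω) [IsProbabilityMeasure μ]
    (W : Ω → Matrix (Fin 2) (Fin 2) ℂ) (hWmeas : Measurable W)
    (hWpsd : ∀ᵐ ω ∂μ, (W ω).PosSemidef)
    (hWsymm : MeasureTheory.Measure.map W μ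
      = MeasureTheory.Measure.map
          (fun ω => Matrix.of fun i j => if i = j then W ω i j else -(W ω i j)) μ)
    (R : Matrix (Fin 2) (Fin 2) ℂ) (hR : R.PosSemidef)
    (hint₁ : Integrable (fun ω => Real.log (Matrix.det (1 + W ω * R)).re) μ)
    (hint₂ : Integrable
        (fun ω => Real.log
          (Matrix.det (1 + W ω * Matrix.diagonal (fun i => R i i))).re) μ) :
    ∫ ω, Real.log (Matrix.det (1 + W ω * R)).re ∂μ
      ≤ ∫ ω, Real.log (Matrix.det (1 + W ω * Matrix.diagonal (fun i => R i i))).re ∂μ := by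
  have hneg : Measurable fun ω => negOffDiag (W ω) := measurable_negOffDiag.comp hWmeas
  have hf := measurable_log_det_one_add_mul R
  have hsymm : Measure.map W μ = Measure.map (fun ω => negOffDiag (W ω)) μ := hWsymm
  have hint₃ : Integrable (fun ω => Real.log (Matrix.det (1 + negOffDiag (W ω) * R)).re) μ := by
    have h := (integrable_map_measure hf.aestronglyMeasurable hWmeas.aemeasurable).2 hint₁
    rw [hsymm] at h
    exact (integrable_map_measure hf.aestronglyMeasurable hneg.aemeasurable).1 h
  have heq : ∫ ω, Real.log (Matrix.det (1 + W ω * R)).re ∂μ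
      = ∫ ω, Real.log (Matrix.det (1 + negOffDiag (W ω) * R)).re ∂μ := by
    rw [← integral_map hWmeas.aemeasurable hf.aestronglyMeasurable,
      ← integral_map hneg.aemeasurable hf.aestronglyMeasurable, hsymm]
  have hle := integral_mono_ae (hint₁.add hint₃) (hint₂.const_mul 2)
    (hWpsd.mono fun ω h => log_det_add_log_det_negOffDiag_le h hR)
  simp only [Pi.add_apply] at hle
  rw [integral_add hint₁ hint₃, integral_const_mul] at hle
  linarith
end

section
/- Fix a partition of {1,…,m} into disjoint nonempty groups I(1),…,I(s), P_T > 0 and P_1,…,P_s > 0, and suppose P_T/m ≤ P_j/|I(j)| for every j = 1,…,s. Let u ∈ ℝ^m be the uniform vector with u_i = P_T/m for all i. Then u ∈ S_P, and for every function f: ℝ^m → ℝ that is symmetric (invariant under permutations of its arguments), concave, and nondecreasing in each coordinate, and every p ∈ S_P, one has f(p) ≤ f(u); moreover f(u) equals the maximum of f over the larger set {p ∈ ℝ^m : p_i ≥ 0, ∑_{i=1}^m p_i ≤ P_T} (the total-power-constraint-only set). -/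
open Finset

/-- A concave function invariant under permutations of its arguments does not decrease when every
coordinate is replaced by the mean of the coordinates. -/
theorem ConcaveOn.le_map_const_mean {m : ℕ} {f : (Fin m → ℝ) → ℝ}
    (hf : ConcaveOn ℝ Set.univ f)
    (hsymm : ∀ σ : Equiv.Perm (Fin m), ∀ p : Fin m → ℝ, f (p ∘ σ) = f p) (p : Fin m → ℝ) :
    f p ≤ f fun _ => (∑ i, p i) / m := by
  rcases Nat.eq_zero_or_pos m with rfl | hm
  · exact (congrArg f (Subsingleton.elim _ _)).le
  have : NeZero m := ⟨hm.ne'⟩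
  have hm' : (m : ℝ) ≠ 0 := Nat.cast_ne_zero.mpr hm.ne'
  have jensen := hf.le_map_sum (t := univ) (w := fun _ : Fin m => (m : ℝ)⁻¹)
    (p := fun k => p ∘ Equiv.addLeft k) (fun _ _ => by positivity)
    (by simp [hm']) (fun _ _ => Set.mem_univ _)
  have mean_shift : ∑ k : Fin m, (m : ℝ)⁻¹ • (p ∘ Equiv.addLeft k) =
      fun _ => (∑ i, p i) / m := by
    funext i
    simp only [Finset.sum_apply, Pi.smul_apply, Function.comp_apply, Equiv.coe_addLeft,
      smul_eq_mul, ← Finset.mul_sum]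
    rw [← Equiv.sum_comp (Equiv.addRight i) p]
    simp only [Equiv.coe_addRight, div_eq_inv_mul]
  rw [mean_shift] at jensen
  simpa only [hsymm, sum_const, card_univ, Fintype.card_fin, nsmul_eq_mul, smul_eq_mul,
    mul_inv_cancel_left₀ hm'] using jensen

/-- Special case 1 for the i.i.d. fading orthogonal channel: if
`P_T/m ≤ P_j/|I(j)|` for every group `j`, then the uniform allocation `u_i = P_T/m` is
feasible under the joint constraints, maximizes every symmetric concave
coordinatewise-nondecreasing function `f` over the feasible set `S_P`, and moreover `f u` is
the maximum of `f` over the larger total-power-constraint-only set.  The antennas are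
partitioned into `s` disjoint nonempty groups via the surjective map `grp : Fin m → Fin s`. -/
theorem stmt_12
    (m s : ℕ)
    (grp : Fin m → Fin s) (hgrp : Function.Surjective grp)
    (PT : ℝ) (hPT : 0 < PT)
    (P : Fin s → ℝ) (hP : ∀ j, 0 < P j)
    (hcond : ∀ j, PT / (m : ℝ) ≤ P j / ((univ.filter (fun i => grp i = j)).card : ℝ))
    (u : Fin m → ℝ) (hu : ∀ i, u i = PT / (m : ℝ)) :
    -- `u` is feasible under the joint constraints
    ((∀ i, 0 ≤ u i) ∧ (∑ i, u i ≤ PT) ∧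
      (∀ j, ∑ i ∈ univ.filter (fun i => grp i = j), u i ≤ P j)) ∧
    (∀ f : (Fin m → ℝ) → ℝ,
      (∀ σ : Equiv.Perm (Fin m), ∀ p : Fin m → ℝ, f (p ∘ σ) = f p) →
      ConcaveOn ℝ Set.univ f →
      Monotone f →
      -- `u` maximizes `f` over the joint feasible set
      ((∀ p : Fin m → ℝ, (∀ i, 0 ≤ p i) → (∑ i, p i ≤ PT) →
          (∀ j, ∑ i ∈ univ.filter (fun i => grp i = j), p i ≤ P j) →
          f p ≤ f u) ∧
        -- `f u` is the maximum of `f` over the total-power-constraint-only set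
        (∀ p : Fin m → ℝ, (∀ i, 0 ≤ p i) → (∑ i, p i ≤ PT) → f p ≤ f u))) := by
  obtain rfl : u = fun _ => PT / (m : ℝ) := funext hu
  have optimal : ∀ f : (Fin m → ℝ) → ℝ,
      (∀ σ : Equiv.Perm (Fin m), ∀ p : Fin m → ℝ, f (p ∘ σ) = f p) →
      ConcaveOn ℝ Set.univ f → Monotone f →
      ∀ p : Fin m → ℝ, (∑ i, p i ≤ PT) → f p ≤ f fun _ => PT / (m : ℝ) :=
    fun f hsymm hconc hmono p hp => (hconc.le_map_const_mean hsymm p).trans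
      (hmono fun _ => div_le_div_of_nonneg_right hp (Nat.cast_nonneg m))
  refine ⟨⟨fun _ => by positivity, ?_, fun j => ?_⟩, fun f hsymm hconc hmono =>
    ⟨fun p _ hp _ => optimal f hsymm hconc hmono p hp,
      fun p _ hp => optimal f hsymm hconc hmono p hp⟩⟩
  · rcases eq_or_ne (m : ℝ) 0 with hm | hm
    · simp [hm, hPT.le]
    · simp [mul_div_cancel₀, hm]
  · obtain ⟨i, hi⟩ := hgrp j
    have card_pos : (0 : ℝ) < (univ.filter fun i => grp i = j).card :=
      Nat.cast_pos.mpr (card_pos.mpr ⟨i, by simp [hi]⟩)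
    rw [sum_const, nsmul_eq_mul, mul_comm]
    exact (le_div_iff₀ card_pos).mp (hcond j)
end

section
/- Fix a partition of {1,…,m} into disjoint nonempty groups I(1),…,I(s), P_T > 0 and P_1,…,P_s > 0, and suppose P_T ≥ ∑_{j=1}^s P_j. Define p* ∈ ℝ^m by p*_i = P_j/|I(j)| for each i ∈ I(j). Then p* ∈ S_P, and for every function f: ℝ^m → ℝ that is symmetric (invariant under permutations of its arguments), concave, and nondecreasing in each coordinate, and every p ∈ S_P, one has f(p) ≤ f(p*); moreover f(p*) equals the maximum of f over the larger set {p ∈ ℝ^m : p_i ≥ 0, ∑_{i∈I(j)} p_i ≤ P_j for each j} (the per-group-constraint-only set). -/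
open Finset

/-- A sum over a fibre of `g` is unchanged by a permutation that preserves `g`. -/
theorem sum_fiber_comp_perm {ι κ : Type*} [Fintype ι] [DecidableEq κ]
    (g : ι → κ) (p : ι → ℝ) (j : κ) (σ : Equiv.Perm ι) (hσ : ∀ i, g (σ i) = g i) :
    ∑ i ∈ univ.filter (fun i => g i = j), p (σ i) = ∑ i ∈ univ.filter (fun i => g i = j), p i :=
  Finset.sum_equiv σ (by simp [hσ]) (by simp)

/-- Averaging a vector over all permutations preserving `g` gives the vector of fibre averages. -/
theorem average_fiber_perms {ι κ : Type*} [Fintype ι] [DecidableEq ι] [DecidableEq κ]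
    (g : ι → κ) (p : ι → ℝ) (i : ι) :
    ∑ σ ∈ univ.filter (fun σ : Equiv.Perm ι => ∀ k, g (σ k) = g k),
      ((univ.filter (fun σ : Equiv.Perm ι => ∀ k, g (σ k) = g k)).card : ℝ)⁻¹ * p (σ i)
      = (∑ k ∈ univ.filter (fun k => g k = g i), p k)
        / ((univ.filter (fun k => g k = g i)).card : ℝ) := by
  set S := univ.filter (fun σ : Equiv.Perm ι => ∀ k, g (σ k) = g k) with hS
  set T := univ.filter (fun k => g k = g i) with hT
  have hS0 : (S.card : ℝ) ≠ 0 :=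
    Nat.cast_ne_zero.2 (card_ne_zero_of_mem (a := 1) (by simp [hS]))
  have hT0 : (T.card : ℝ) ≠ 0 :=
    Nat.cast_ne_zero.2 (card_ne_zero_of_mem (a := i) (by simp [hT]))
  have hconst : ∀ k ∈ T, ∑ σ ∈ S, p (σ k) = ∑ σ ∈ S, p (σ i) := by
    intro k hk
    have hk' : g k = g i := by simpa [hT] using hk
    have hswap : ∀ l, g (Equiv.swap i k l) = g l := by
      intro l
      rw [Equiv.swap_apply_def]
      split_ifs with h₁ h₂
      · rw [h₁, hk']
      · rw [h₂, hk']
      · rfl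
    refine Finset.sum_equiv (Equiv.mulRight (Equiv.swap i k)) (fun σ => ?_) (by simp)
    simp only [hS, mem_filter, mem_univ, true_and, Equiv.coe_mulRight, Equiv.Perm.mul_apply]
    refine ⟨fun h l => by rw [h, hswap], fun h l => ?_⟩
    have := h (Equiv.swap i k l)
    rwa [Equiv.swap_apply_self, hswap] at this
  have hdouble : (T.card : ℝ) * ∑ σ ∈ S, p (σ i) = S.card * ∑ k ∈ T, p k := by
    rw [← nsmul_eq_mul, ← nsmul_eq_mul, ← sum_const, ← sum_const, ← sum_congr rfl hconst, sum_comm]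
    refine sum_congr rfl fun σ hσ => sum_fiber_comp_perm g p (g i) σ ?_
    simpa [hS] using hσ
  rw [← mul_sum, eq_div_iff hT0, mul_assoc, mul_comm _ (T.card : ℝ), hdouble,
    inv_mul_cancel_left₀ hS0]

/-- A symmetric concave function does not decrease when a vector is averaged over fibres. -/
theorem ConcaveOn.le_map_fiber_average {ι κ : Type*} [Fintype ι] [DecidableEq κ]
    (g : ι → κ) {f : (ι → ℝ) → ℝ} (hsymm : ∀ (σ : Equiv.Perm ι) (p : ι → ℝ), f (p ∘ σ) = f p)
    (hf : ConcaveOn ℝ Set.univ f) (p : ι → ℝ) :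
    f p ≤ f (fun i => (∑ k ∈ univ.filter (fun k => g k = g i), p k)
        / ((univ.filter (fun k => g k = g i)).card : ℝ)) := by
  classical
  set S := univ.filter (fun σ : Equiv.Perm ι => ∀ k, g (σ k) = g k) with hS
  have hS0 : (S.card : ℝ) ≠ 0 :=
    Nat.cast_ne_zero.2 (card_ne_zero_of_mem (a := 1) (by simp [hS]))
  have hw : ∑ _σ ∈ S, (S.card : ℝ)⁻¹ = 1 := by
    rw [sum_const, nsmul_eq_mul, mul_inv_cancel₀ hS0]
  have hjensen := hf.le_map_sum (t := S) (w := fun _ => (S.card : ℝ)⁻¹)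
    (p := fun σ : Equiv.Perm ι => p ∘ σ) (fun _ _ => by positivity) hw
    (fun _ _ => Set.mem_univ _)
  simp only [hsymm, ← sum_smul, hw, one_smul] at hjensen
  refine hjensen.trans_eq (congrArg f (funext fun i => ?_))
  rw [← average_fiber_perms g p i]
  simp [hS, Finset.sum_apply]

/-- Special case 2 for the i.i.d. fading orthogonal channel: if
`P_T ≥ ∑ j, P_j`, then the allocation `p*_i = P_j/|I(j)|` for `i ∈ I(j)` is feasible under
the joint constraints, maximizes every symmetric concave coordinatewise-nondecreasing
function `f` over the feasible set `S_P`, and moreover `f p*` is the maximum of `f` over the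
larger per-group-constraint-only set.  The antennas are partitioned into `s` disjoint
nonempty groups via the surjective map `grp : Fin m → Fin s`. -/
theorem stmt_13
    (m s : ℕ)
    (grp : Fin m → Fin s) (hgrp : Function.Surjective grp)
    (PT : ℝ) (hPT : 0 < PT)
    (P : Fin s → ℝ) (hP : ∀ j, 0 < P j)
    (hcond : ∑ j, P j ≤ PT)
    (pstar : Fin m → ℝ)
    (hpstar : ∀ i, pstar i
      = P (grp i) / ((univ.filter (fun i' => grp i' = grp i)).card : ℝ)) :
    -- `p*` is feasible under the joint constraints
    ((∀ i, 0 ≤ pstar i) ∧ (∑ i, pstar i ≤ PT) ∧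
      (∀ j, ∑ i ∈ univ.filter (fun i => grp i = j), pstar i ≤ P j)) ∧
    (∀ f : (Fin m → ℝ) → ℝ,
      (∀ σ : Equiv.Perm (Fin m), ∀ p : Fin m → ℝ, f (p ∘ σ) = f p) →
      ConcaveOn ℝ Set.univ f →
      Monotone f →
      -- `p*` maximizes `f` over the joint feasible set
      ((∀ p : Fin m → ℝ, (∀ i, 0 ≤ p i) → (∑ i, p i ≤ PT) →
          (∀ j, ∑ i ∈ univ.filter (fun i => grp i = j), p i ≤ P j) →
          f p ≤ f pstar) ∧
        -- `f p*` is the maximum of `f` over the per-group-constraint-only set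
        (∀ p : Fin m → ℝ, (∀ i, 0 ≤ p i) →
          (∀ j, ∑ i ∈ univ.filter (fun i => grp i = j), p i ≤ P j) →
          f p ≤ f pstar))) := by
  have hsum : ∀ j, ∑ i ∈ univ.filter (fun i => grp i = j), pstar i = P j := by
    intro j
    obtain ⟨i, rfl⟩ := hgrp j
    have hcard : ((univ.filter (fun k => grp k = grp i)).card : ℝ) ≠ 0 :=
      Nat.cast_ne_zero.2 (card_ne_zero_of_mem (a := i) (by simp))
    have hconst : ∀ k ∈ univ.filter (fun k => grp k = grp i),
        pstar k = P (grp i) / ((univ.filter (fun k => grp k = grp i)).card : ℝ) := by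
      intro k hk
      rw [hpstar k, (mem_filter.1 hk).2]
    rw [sum_congr rfl hconst, sum_const, nsmul_eq_mul, mul_div_cancel₀ _ hcard]
  refine ⟨⟨fun i => ?_, ?_, fun j => (hsum j).le⟩, fun f hsymm hf hmono => ?_⟩
  · rw [hpstar]
    exact div_nonneg (hP _).le (Nat.cast_nonneg _)
  · rw [← sum_fiberwise univ grp pstar, sum_congr rfl fun j _ => hsum j]
    exact hcond
  · have hmax : ∀ p : Fin m → ℝ,
        (∀ j, ∑ i ∈ univ.filter (fun i => grp i = j), p i ≤ P j) → f p ≤ f pstar := by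
      intro p hp
      refine (hf.le_map_fiber_average grp hsymm p).trans (hmono fun i => ?_)
      rw [hpstar i]
      exact div_le_div_of_nonneg_right (hp _) (Nat.cast_nonneg _)
    exact ⟨fun p _ _ hp => hmax p hp, fun p _ hp => hmax p hp⟩
end

section
/- Let (g_1,…,g_m) be a random vector of nonnegative integrable real random variables whose joint law is exchangeable (invariant under every permutation of the m coordinates), and define F(p) = E[ ln(1 + ∑_{i=1}^m g_i p_i) ] for p ∈ ℝ^m with p_i ≥ 0. Then F is Schur-concave: if p, q ∈ ℝ^m have nonnegative entries and p is majorized by q, then F(p) ≥ F(q). -/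
open Finset MeasureTheory

/-- Abel summation: an antitone weight applied to a sequence with nonnegative partial sums. -/
lemma mul_sum_Iic_le_sum_Iic_mul {m : ℕ} {c d : Fin m → ℝ} (hc : Antitone c)
    (hd : ∀ k, 0 ≤ ∑ i ∈ Iic k, d i) (k : Fin m) :
    c k * ∑ i ∈ Iic k, d i ≤ ∑ i ∈ Iic k, c i * d i := by
  obtain ⟨k, hk⟩ := k
  induction k with
  | zero =>
    have h : Iic (⟨0, hk⟩ : Fin m) = {⟨0, hk⟩} := by
      ext i
      simp [Fin.le_def, Fin.ext_iff]
    simp [h]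
  | succ k ih =>
    have hk' : k < m := by omega
    have h : Iic (⟨k + 1, hk⟩ : Fin m) = insert ⟨k + 1, hk⟩ (Iic ⟨k, hk'⟩) := by
      ext i
      simp only [mem_Iic, mem_insert, Fin.le_def, Fin.ext_iff]
      omega
    have hnot : (⟨k + 1, hk⟩ : Fin m) ∉ Iic (⟨k, hk'⟩ : Fin m) := by
      simp [Fin.le_def]
    rw [h, sum_insert hnot, sum_insert hnot]
    have hle : c ⟨k + 1, hk⟩ ≤ c ⟨k, hk'⟩ := hc (by simp [Fin.le_def])
    have := mul_le_mul_of_nonneg_right hle (hd ⟨k, hk'⟩)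
    linarith [ih hk']

lemma sum_mul_nonneg_of_antitone {m : ℕ} {c d : Fin m → ℝ} (hc : Antitone c)
    (hd : ∀ k, 0 ≤ ∑ i ∈ Iic k, d i) (h0 : ∑ i, d i = 0) : 0 ≤ ∑ i, c i * d i := by
  cases m with
  | zero => simp
  | succ n =>
    have h : Iic (Fin.last n) = univ := by
      ext i
      simp [Fin.le_last]
    have := mul_sum_Iic_le_sum_Iic_mul hc hd (Fin.last n)
    rwa [h, h0, mul_zero] at this

lemma exists_perm_antitone_comp {m : ℕ} (c : Fin m → ℝ) :
    ∃ ρ : Equiv.Perm (Fin m), Antitone (c ∘ ρ) :=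
  ⟨Tuple.sort (fun i => -c i), fun _ _ hij =>
    neg_le_neg_iff.mp (Tuple.monotone_sort (fun i => -c i) hij)⟩

/-- A vector majorized by `y` pairs with any weight at most as well as some rearrangement of
`y`. -/
lemma IsMajorizedBy.exists_perm_sum_mul_le {m : ℕ} {x y : Fin m → ℝ} (h : IsMajorizedBy x y)
    (c : Fin m → ℝ) : ∃ π : Equiv.Perm (Fin m), ∑ i, c i * x i ≤ ∑ i, c i * y (π i) := by
  obtain ⟨σ, τ, hx, hy, hpart, htot⟩ := h
  obtain ⟨ρ, hρ⟩ := exists_perm_antitone_comp c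
  refine ⟨ρ⁻¹.trans τ, ?_⟩
  have hmono : Monovary (c ∘ ρ) (x ∘ σ) := hρ.monovary hx
  have hrearr : ∑ i, c i * x i ≤ ∑ i, c (ρ i) * x (σ i) := by
    have := hmono.sum_mul_comp_perm_le_sum_mul (σ := ρ.trans σ⁻¹)
    simpa [Equiv.sum_comp ρ (fun i => c i * x i)] using this
  have habel : 0 ≤ ∑ i, (c ∘ ρ) i * (y (τ i) - x (σ i)) := by
    refine sum_mul_nonneg_of_antitone hρ (fun k => ?_) ?_
    · have hk : Iic k = univ.filter (· ≤ k) := by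
        ext i
        simp
      rw [sum_sub_distrib, hk]
      exact sub_nonneg.mpr (hpart k)
    · rw [sum_sub_distrib, Equiv.sum_comp τ y, Equiv.sum_comp σ x, htot, sub_self]
  have hre : ∑ i, c i * y ((ρ⁻¹.trans τ) i) = ∑ i, c (ρ i) * y (τ i) := by
    rw [← Equiv.sum_comp ρ]
    simp
  simp only [Function.comp_apply, mul_sub, sum_sub_distrib] at habel
  linarith

/-- Rado's theorem: a vector majorized by `y` is a convex combination of rearrangements of
`y`. -/
lemma IsMajorizedBy.mem_convexHull {m : ℕ} {x y : Fin m → ℝ} (h : IsMajorizedBy x y) :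
    x ∈ convexHull ℝ (Set.range fun π : Equiv.Perm (Fin m) => y ∘ π) := by
  by_contra hx
  obtain ⟨f, u, hf, hu⟩ := geometric_hahn_banach_closed_point (convex_convexHull ℝ _)
    ((Set.finite_range _).isClosed_convexHull ℝ) hx
  have hrep (z : Fin m → ℝ) : f z = ∑ i, f (Pi.single i 1) * z i := by
    have := LinearMap.pi_apply_eq_sum_univ f.toLinearMap z
    simp only [ContinuousLinearMap.coe_coe, smul_eq_mul] at this
    rw [this]
    refine sum_congr rfl fun i _ => ?_
    rw [mul_comm]
    congr 2
    ext j
    simp [Pi.single_apply, eq_comm]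
  obtain ⟨π, hπ⟩ := h.exists_perm_sum_mul_le fun i => f (Pi.single i 1)
  have hlt := hf (y ∘ π) (subset_convexHull ℝ _ ⟨π, rfl⟩)
  rw [hrep] at hlt hu
  simp only [Function.comp_apply] at hlt
  linarith

lemma integrable_log_one_add_sum {Ω : Type*} [MeasurableSpace Ω] {μ : Measure Ω} {m : ℕ}
    {g : Ω → Fin m → ℝ} (hmeas : Measurable g) (hnn : ∀ ω i, 0 ≤ g ω i)
    (hint : ∀ i, Integrable (fun ω => g ω i) μ) {p : Fin m → ℝ} (hp : ∀ i, 0 ≤ p i) :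
    Integrable (fun ω => Real.log (1 + ∑ i, g ω i * p i)) μ := by
  have hsum : Integrable (fun ω => ∑ i, g ω i * p i) μ :=
    integrable_finsetSum _ fun i _ => (hint i).mul_const _
  refine hsum.mono' (Measurable.aestronglyMeasurable (by fun_prop)) (.of_forall fun ω => ?_)
  have h0 : 0 ≤ ∑ i, g ω i * p i := sum_nonneg fun i _ => mul_nonneg (hnn ω i) (hp i)
  rw [Real.norm_of_nonneg (Real.log_nonneg (by linarith))]
  linarith [Real.log_le_sub_one_of_pos (show 0 < 1 + ∑ i, g ω i * p i by linarith)]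

lemma concaveOn_integral_log_one_add_sum {Ω : Type*} [MeasurableSpace Ω] {μ : Measure Ω}
    {m : ℕ} {g : Ω → Fin m → ℝ} (hmeas : Measurable g) (hnn : ∀ ω i, 0 ≤ g ω i)
    (hint : ∀ i, Integrable (fun ω => g ω i) μ) :
    ConcaveOn ℝ {p : Fin m → ℝ | ∀ i, 0 ≤ p i}
      (fun p => ∫ ω, Real.log (1 + ∑ i, g ω i * p i) ∂μ) := by
  have hconv : Convex ℝ {p : Fin m → ℝ | ∀ i, 0 ≤ p i} := convex_Ici (0 : Fin m → ℝ)
  refine ⟨hconv, fun p hp q hq a b ha hb hab => ?_⟩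
  have hip := integrable_log_one_add_sum hmeas hnn hint hp
  have hiq := integrable_log_one_add_sum hmeas hnn hint hq
  simp only [smul_eq_mul]
  rw [← integral_const_mul, ← integral_const_mul,
    ← integral_add (hip.const_mul a) (hiq.const_mul b)]
  refine integral_mono ((hip.const_mul a).add (hiq.const_mul b))
    (integrable_log_one_add_sum hmeas hnn hint (hconv hp hq ha hb hab)) fun ω => ?_
  have hpos {r : Fin m → ℝ} (hr : ∀ i, 0 ≤ r i) : 0 < 1 + ∑ i, g ω i * r i :=
    add_pos_of_pos_of_nonneg one_pos (sum_nonneg fun i _ => mul_nonneg (hnn ω i) (hr i))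
  have hlog := strictConcaveOn_log_Ioi.concaveOn.2 (hpos hp) (hpos hq) ha hb hab
  have heq : a * (1 + ∑ i, g ω i * p i) + b * (1 + ∑ i, g ω i * q i)
      = 1 + ∑ i, g ω i * (a • p + b • q) i := by
    simp only [Pi.add_apply, Pi.smul_apply, smul_eq_mul, mul_add, sum_add_distrib, mul_sum,
      mul_left_comm (g ω _)]
    linarith
  simpa only [smul_eq_mul, heq] using hlog

lemma integral_log_one_add_sum_comp_perm {Ω : Type*} [MeasurableSpace Ω] {μ : Measure Ω}
    {m : ℕ} {g : Ω → Fin m → ℝ} (hmeas : Measurable g)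
    (hexch : ∀ σ : Equiv.Perm (Fin m), Measure.map (fun ω => g ω ∘ σ) μ = Measure.map g μ)
    (q : Fin m → ℝ) (π : Equiv.Perm (Fin m)) :
    ∫ ω, Real.log (1 + ∑ i, g ω i * q (π i)) ∂μ
      = ∫ ω, Real.log (1 + ∑ i, g ω i * q i) ∂μ := by
  have hφ : Measurable fun v : Fin m → ℝ => Real.log (1 + ∑ i, v i * q (π i)) := by fun_prop
  have hcomp : Measurable fun ω => g ω ∘ π :=
    measurable_pi_lambda _ fun i => (measurable_pi_apply (π i)).comp hmeas
  rw [← integral_map hmeas.aemeasurable hφ.aestronglyMeasurable, ← hexch π,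
    integral_map hcomp.aemeasurable hφ.aestronglyMeasurable]
  refine integral_congr_ae (.of_forall fun ω => ?_)
  simp only [Function.comp_apply, Equiv.sum_comp π fun i => g ω i * q i]

/-- Schur-concavity of the ergodic MISO rate: if the random vector
`(g 0, …, g (m-1))` of nonnegative integrable random variables has an exchangeable joint law
and `F p = E[ln (1 + ∑ i, g i * p i)]`, then for nonnegative `p`, `q` with `p` majorized by
`q`, one has `F p ≥ F q`. -/
theorem stmt_14
    {Ω : Type*} [MeasurableSpace Ω] (μ : MeasureTheory.Measure Ω) [IsProbabilityMeasure μ]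
    (m : ℕ) (g : Ω → Fin m → ℝ)
    (hmeas : Measurable g)
    (hnn : ∀ ω i, 0 ≤ g ω i)
    (hint : ∀ i, Integrable (fun ω => g ω i) μ)
    (hexch : ∀ σ : Equiv.Perm (Fin m),
      MeasureTheory.Measure.map (fun ω => g ω ∘ σ) μ = MeasureTheory.Measure.map g μ)
    (F : (Fin m → ℝ) → ℝ)
    (hF : ∀ p, F p = ∫ ω, Real.log (1 + ∑ i, g ω i * p i) ∂μ) :
    ∀ p q : Fin m → ℝ, (∀ i, 0 ≤ p i) → (∀ i, 0 ≤ q i) →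
      IsMajorizedBy p q → F q ≤ F p := by
  intro p q _ hq hpq
  have hconc := concaveOn_integral_log_one_add_sum hmeas hnn hint
  have hsub : Set.range (fun π : Equiv.Perm (Fin m) => q ∘ π) ⊆
      {r ∈ {r : Fin m → ℝ | ∀ i, 0 ≤ r i} |
        F q ≤ ∫ ω, Real.log (1 + ∑ i, g ω i * r i) ∂μ} := by
    rintro _ ⟨π, rfl⟩
    refine ⟨fun i => hq (π i), ?_⟩
    rw [hF]
    exact (integral_log_one_add_sum_comp_perm hmeas hexch q π).ge
  rw [hF p]
  exact (convexHull_min hsub (hconc.convex_ge (F q)) hpq.mem_convexHull).2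
end

section
/- Let H be a random n×m complex matrix on a probability space whose law is right unitarily invariant: for every m×m unitary matrix U, the law of H·U equals the law of H. Let R be a (deterministic) m×m complex Hermitian positive semidefinite matrix with diagonal entries d_i = R_{ii} (real, nonnegative), and let λ_1,…,λ_m be the eigenvalues of R. Assume that ω ↦ ln det(I_n + H(ω)·D·H(ω)*) is integrable for every diagonal m×m matrix D with nonnegative diagonal entries, and that ω ↦ ln det(I_n + H(ω)·R·H(ω)*) is integrable (all these determinants are real and ≥ 1). Then E[ ln det(I_n + H·R·H*) ] ≤ E[ ln det(I_n + H·diag(d_1,…,d_m)·H*) ]. -/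
open Matrix ComplexOrder MeasureTheory

namespace Matrix

/-- The logarithm of the determinant of a positive definite matrix `M` is at most
`tr (M - 1)`. -/
theorem PosDef.log_det_le_trace_sub_card {ι : Type*} [Fintype ι] [DecidableEq ι]
    {M : Matrix ι ι ℂ} (hM : M.PosDef) :
    Real.log M.det.re ≤ M.trace.re - Fintype.card ι := by
  have hdet : M.det.re = ∏ i, hM.isHermitian.eigenvalues i := by
    rw [hM.isHermitian.det_eq_prod_eigenvalues]
    exact_mod_cast Complex.ofReal_re (∏ i, hM.isHermitian.eigenvalues i)
  have htr : M.trace.re = ∑ i, hM.isHermitian.eigenvalues i := by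
    rw [hM.isHermitian.trace_eq_sum_eigenvalues]
    exact_mod_cast Complex.ofReal_re (∑ i, hM.isHermitian.eigenvalues i)
  rw [hdet, htr, Real.log_prod fun i _ => (hM.eigenvalues_pos i).ne']
  calc ∑ i, Real.log (hM.isHermitian.eigenvalues i)
      ≤ ∑ i, (hM.isHermitian.eigenvalues i - 1) :=
        Finset.sum_le_sum fun i _ => Real.log_le_sub_one_of_pos (hM.eigenvalues_pos i)
    _ = _ := by simp

open scoped MatrixOrder Matrix.Norms.L2Operator in
/-- The graph of `log det` lies below its tangent at each positive definite matrix `Y`. -/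
theorem PosDef.log_det_le_log_det_add {ι : Type*} [Fintype ι] [DecidableEq ι]
    {X Y : Matrix ι ι ℂ} (hX : X.PosDef) (hY : Y.PosDef) :
    Real.log X.det.re ≤ Real.log Y.det.re + ((Y⁻¹ * X).trace.re - Fintype.card ι) := by
  obtain ⟨B, hB, hYB⟩ : ∃ B : Matrix ι ι ℂ, IsUnit B ∧ Y⁻¹ = Bᴴ * B := by
    simpa [star_eq_conjTranspose] using
      CStarAlgebra.isStrictlyPositive_iff_eq_star_mul_self.mp hY.inv.isStrictlyPositive
  have hM : (B * X * Bᴴ).PosDef :=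
    hX.mul_mul_conjTranspose_same (vecMul_injective_iff_isUnit.mpr hB)
  have hdetX : (X.det.re : ℂ) = X.det := (Complex.eq_re_of_ofReal_le hX.det_pos.le).symm
  have hdetY : (Y.det.re : ℂ) = Y.det := (Complex.eq_re_of_ofReal_le hY.det_pos.le).symm
  have hXpos : 0 < X.det.re := (Complex.pos_iff.mp hX.det_pos).1
  have hYpos : 0 < Y.det.re := (Complex.pos_iff.mp hY.det_pos).1
  have hdet : (B * X * Bᴴ).det = ((X.det.re / Y.det.re : ℝ) : ℂ) := by
    have h : (Bᴴ * B).det = Y.det⁻¹ := by rw [← hYB, det_nonsing_inv, Ring.inverse_eq_inv']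
    rw [det_mul] at h
    rw [det_mul, det_mul, Complex.ofReal_div, hdetX, hdetY, div_eq_mul_inv, ← h]
    ring
  have htr : (B * X * Bᴴ).trace = (Y⁻¹ * X).trace := by
    rw [hYB, trace_mul_comm, mul_assoc]
  have := hM.log_det_le_trace_sub_card
  rw [hdet, htr, Complex.ofReal_re, Real.log_div hXpos.ne' hYpos.ne'] at this
  linarith

/-- Jensen's inequality for `log det`, with uniform weights. -/
theorem PosDef.sum_log_det_le {ι κ : Type*} [Fintype ι] [DecidableEq ι] [Fintype κ]
    {X : κ → Matrix ι ι ℂ} {Y : Matrix ι ι ℂ} (hX : ∀ k, (X k).PosDef) (hY : Y.PosDef)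
    (hsum : ∑ k, X k = (Fintype.card κ : ℂ) • Y) :
    ∑ k, Real.log (X k).det.re ≤ Fintype.card κ * Real.log Y.det.re := by
  have htr : ∑ k, (Y⁻¹ * X k).trace.re = Fintype.card κ * Fintype.card ι := by
    rw [← Complex.re_sum, ← trace_sum, ← Matrix.mul_sum, hsum, Matrix.mul_smul, Y.nonsing_inv_mul
      hY.det_pos.ne'.isUnit, trace_smul, trace_one]
    simp
  calc ∑ k, Real.log (X k).det.re
      ≤ ∑ k, (Real.log Y.det.re + ((Y⁻¹ * X k).trace.re - Fintype.card ι)) :=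
        Finset.sum_le_sum fun k _ => (hX k).log_det_le_log_det_add hY
    _ = _ := by simp [Finset.sum_add_distrib, Finset.sum_sub_distrib, htr]

/-- Distinct coordinates of a uniformly random sign vector are uncorrelated. -/
theorem sum_units_mul_units {ι : Type*} [Fintype ι] [DecidableEq ι] (i j : ι) :
    ∑ s : ι → ℤˣ, ((s i : ℤ) : ℂ) * ((s j : ℤ) : ℂ)
      = if i = j then (Fintype.card (ι → ℤˣ) : ℂ) else 0 := by
  split_ifs with h
  · subst h
    have (s : ι → ℤˣ) : ((s i : ℤ) : ℂ) * ((s i : ℤ) : ℂ) = 1 := by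
      rw [← Int.cast_mul, ← Units.val_mul, Int.units_mul_self]; simp
    simp [this]
  · have key := Equiv.sum_comp (Equiv.mulLeft (Pi.mulSingle i (-1) : ι → ℤˣ))
      fun s : ι → ℤˣ => ((s i : ℤ) : ℂ) * ((s j : ℤ) : ℂ)
    simp only [Equiv.coe_mulLeft, Pi.mul_apply, Pi.mulSingle_eq_same,
      Pi.mulSingle_eq_of_ne (Ne.symm h), one_mul, neg_mul, Units.val_neg, Int.cast_neg,
      Finset.sum_neg_distrib] at key
    exact self_eq_neg.mp key.symm

/-- The diagonal matrix of a sign vector. -/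
def signDiagonal {ι : Type*} [DecidableEq ι] (s : ι → ℤˣ) : Matrix ι ι ℂ :=
  diagonal fun i => ((s i : ℤ) : ℂ)

theorem signDiagonal_conjTranspose {ι : Type*} [DecidableEq ι] (s : ι → ℤˣ) :
    (signDiagonal s)ᴴ = signDiagonal s := by
  rw [signDiagonal, diagonal_conjTranspose]
  congr 1
  ext i
  simp

theorem signDiagonal_mem_unitaryGroup {ι : Type*} [Fintype ι] [DecidableEq ι] (s : ι → ℤˣ) :
    signDiagonal s ∈ unitaryGroup ι ℂ := by
  rw [mem_unitaryGroup_iff, star_eq_conjTranspose, signDiagonal_conjTranspose, signDiagonal,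
    diagonal_mul_diagonal, ← diagonal_one]
  congr 1
  ext i
  rw [← Int.cast_mul, ← Units.val_mul, Int.units_mul_self]
  simp

/-- Averaging over conjugations by sign matrices leaves the diagonal of a matrix. -/
theorem sum_signDiagonal_conj {ι : Type*} [Fintype ι] [DecidableEq ι] (R : Matrix ι ι ℂ) :
    ∑ s : ι → ℤˣ, signDiagonal s * R * signDiagonal s
      = (Fintype.card (ι → ℤˣ) : ℂ) • diagonal fun i => R i i := by
  ext i j
  have h (s : ι → ℤˣ) : (signDiagonal s * R * signDiagonal s) i j
      = ((s i : ℤ) : ℂ) * ((s j : ℤ) : ℂ) * R i j := by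
    rw [signDiagonal, mul_diagonal, diagonal_mul]
    ring
  rw [sum_apply, Finset.sum_congr rfl fun s _ => h s, ← Finset.sum_mul, sum_units_mul_units,
    smul_apply, diagonal_apply]
  split_ifs with hij
  · simp [hij]
  · simp

theorem PosSemidef.posDef_one_add_mul_mul_conjTranspose {ι κ : Type*} [Fintype ι]
    [DecidableEq ι] [Fintype κ] {R : Matrix κ κ ℂ} (hR : R.PosSemidef) (A : Matrix ι κ ℂ) :
    (1 + A * R * Aᴴ).PosDef :=
  PosDef.one.add_posSemidef (hR.mul_mul_conjTranspose_same A)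

/-- For fixed `A`, the log-determinant at the diagonal of `R` dominates the average of the
log-determinants over all sign changes of the columns of `A`. -/
theorem PosSemidef.sum_log_det_signDiagonal_le {ι κ : Type*} [Fintype ι]
    [DecidableEq ι] [Fintype κ] [DecidableEq κ] {R : Matrix κ κ ℂ} (hR : R.PosSemidef)
    (A : Matrix ι κ ℂ) :
    ∑ s : κ → ℤˣ, Real.log
        (1 + (A * signDiagonal s) * R * (A * signDiagonal s)ᴴ).det.re
      ≤ Fintype.card (κ → ℤˣ) *
        Real.log (1 + A * diagonal (fun i => R i i) * Aᴴ).det.re := by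
  refine PosDef.sum_log_det_le (fun s => hR.posDef_one_add_mul_mul_conjTranspose _)
    (PosSemidef.posDef_one_add_mul_mul_conjTranspose
      (PosSemidef.diagonal fun i => hR.diag_nonneg) A) ?_
  have h (s : κ → ℤˣ) : (A * signDiagonal s) * R * (A * signDiagonal s)ᴴ
      = A * (signDiagonal s * R * signDiagonal s) * Aᴴ := by
    rw [conjTranspose_mul, signDiagonal_conjTranspose]
    simp only [Matrix.mul_assoc]
  simp_rw [h]
  rw [Finset.sum_add_distrib, ← Matrix.sum_mul, ← Matrix.mul_sum, sum_signDiagonal_conj,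
    Matrix.mul_smul, Matrix.smul_mul, smul_add]
  simp only [Finset.sum_const, Finset.card_univ, Nat.cast_smul_eq_nsmul]

theorem measurable_log_det_one_add {ι κ : Type*} [Fintype ι] [DecidableEq ι] [Fintype κ]
    (R : Matrix κ κ ℂ) :
    Measurable fun A : Matrix ι κ ℂ => Real.log (1 + A * R * Aᴴ).det.re := by
  have : BorelSpace (Matrix ι κ ℂ) := inferInstanceAs (BorelSpace (ι → κ → ℂ))
  refine Real.measurable_log.comp (Continuous.measurable ?_)
  fun_prop

theorem measurable_mul_right {ι κ : Type*} [Fintype κ] [Finite ι] (U : Matrix κ κ ℂ) :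
    Measurable fun A : Matrix ι κ ℂ => A * U := by
  have : BorelSpace (Matrix ι κ ℂ) := inferInstanceAs (BorelSpace (ι → κ → ℂ))
  exact Continuous.measurable (by fun_prop)

end Matrix

/-- Let `H` be a random `n × m` complex matrix whose law is right unitarily
invariant, and let `R` be a deterministic Hermitian positive semidefinite matrix with
diagonal entries `d i = (R i i).re`.  Assuming integrability of the relevant
log-determinants, the expected log-determinant does not decrease when `R` is replaced by the
diagonal matrix with the same diagonal:
`E[ln det (Iₙ + H R Hᴴ)] ≤ E[ln det (Iₙ + H diag(d) Hᴴ)]`. -/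
theorem stmt_15
    {Ω : Type*} [MeasurableSpace Ω] (μ : MeasureTheory.Measure Ω) [IsProbabilityMeasure μ]
    (n m : ℕ)
    (H : Ω → Matrix (Fin n) (Fin m) ℂ) (hHmeas : Measurable H)
    (hinv : ∀ U : Matrix (Fin m) (Fin m) ℂ, U ∈ Matrix.unitaryGroup (Fin m) ℂ →
      MeasureTheory.Measure.map (fun ω => H ω * U) μ = MeasureTheory.Measure.map H μ)
    (R : Matrix (Fin m) (Fin m) ℂ) (hR : R.PosSemidef)
    (hintD : ∀ D : Fin m → ℝ, (∀ i, 0 ≤ D i) →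
      Integrable (fun ω =>
        Real.log (Matrix.det
          (1 + H ω * Matrix.diagonal (fun i => (D i : ℂ)) * (H ω)ᴴ)).re) μ)
    (hintR : Integrable
      (fun ω => Real.log (Matrix.det (1 + H ω * R * (H ω)ᴴ)).re) μ) :
    ∫ ω, Real.log (Matrix.det (1 + H ω * R * (H ω)ᴴ)).re ∂μ
      ≤ ∫ ω, Real.log (Matrix.det
          (1 + H ω * Matrix.diagonal (fun i => ((R i i).re : ℂ)) * (H ω)ᴴ)).re ∂μ := by
  have hident (s : Fin m → ℤˣ) : ProbabilityTheory.IdentDistrib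
      (fun ω => Real.log (1 + (H ω * signDiagonal s) * R * (H ω * signDiagonal s)ᴴ).det.re)
      (fun ω => Real.log (1 + H ω * R * (H ω)ᴴ).det.re) μ μ :=
    ProbabilityTheory.IdentDistrib.comp
      (f := fun ω => H ω * signDiagonal s) (g := H)
      ⟨((measurable_mul_right _).comp hHmeas).aemeasurable, hHmeas.aemeasurable,
        hinv _ (signDiagonal_mem_unitaryGroup s)⟩
      (measurable_log_det_one_add R)
  have hdiag : (fun i => ((R i i).re : ℂ)) = fun i => R i i :=
    funext fun i => hR.isHermitian.coe_re_apply_self i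
  have hintdiag := hintD (fun i => (R i i).re) fun i => (Complex.nonneg_iff.mp hR.diag_nonneg).1
  rw [hdiag] at hintdiag ⊢
  have hmono := integral_mono
    (integrable_finsetSum Finset.univ fun s _ => (hident s).integrable_iff.mpr hintR)
    (hintdiag.const_mul (Fintype.card (Fin m → ℤˣ) : ℝ))
    fun ω => hR.sum_log_det_signDiagonal_le (H ω)
  rw [integral_finsetSum _ fun s _ => (hident s).integrable_iff.mpr hintR,
    integral_const_mul, Finset.sum_congr rfl fun s _ => (hident s).integral_eq,
    Finset.sum_const, Finset.card_univ, nsmul_eq_mul] at hmono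
  exact le_of_mul_le_mul_left hmono (by exact_mod_cast Fintype.card_pos)
end
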